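/- arXiv:2506.15221 — 8 statements merged into one kernel-verified Lean document; each statement's English description precedes it below -/
import Mathlib

section
/- Let n ≥ 3 and let F(i,j) = (i-1)·n − C(i,2) + j − i for 1 ≤ i < j ≤ n. Define the vertex sum S_i = Σ_{p=1}^{i-1} F(p,i) + Σ_{q=i+1}^{n} F(i,q) for 1 ≤ i ≤ n. Then the vertex sums S_1, S_2, …, S_n are pairwise distinct; that is, if 1 ≤ i < j ≤ n then S_i ≠ S_j. In particular, the labeling F is an antimagic labeling of the complete directed graph on n vertices oriented from smaller to larger index. -/
theorem two_mul_cast_choose_two (p : ℕ) : 2 * (p.choose 2 : ℤ) = p * (p - 1) := by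
  induction p with
  | zero => simp
  | succ p ih =>
    rw [Nat.choose_succ_succ' p 1, Nat.choose_one_right]
    push_cast
    linarith

/-- Closed form for the sum of the labels of the edges entering a vertex. -/
theorem six_mul_sum_in_labels (a x : ℤ) (m : ℕ) :
    6 * ∑ p ∈ Finset.Icc 1 m, (((p : ℤ) - 1) * a - (p.choose 2 : ℤ) + x - p) =
      3 * a * m * (m - 1) - (m + 1) * m * (m - 1) + 6 * x * m - 3 * m * (m + 1) := by
  induction m with
  | zero => simp
  | succ m ih =>
    rw [Finset.sum_Icc_succ_top (by omega), mul_add, ih]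
    have h := two_mul_cast_choose_two (m + 1)
    push_cast at h ⊢
    linear_combination -3 * h

/-- Closed form for the sum of the labels of the edges leaving a vertex. -/
theorem two_mul_sum_out_labels (c : ℤ) (i k : ℕ) :
    2 * ∑ q ∈ Finset.Icc (i + 1) (i + k), (c + (q : ℤ) - i) = 2 * k * c + k * (k + 1) := by
  induction k with
  | zero => simp
  | succ k ih =>
    rw [← add_assoc, Finset.sum_Icc_succ_top (by omega), mul_add, ih]
    push_cast
    ring


/-- For `n ≥ 3`, the vertex sums `S_i = Σ_{p=1}^{i-1} F(p,i) + Σ_{q=i+1}^{n} F(i,q)` of the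
labeling `F(i,j) = (i-1)·n − C(i,2) + j − i` of the complete directed graph on `n` vertices
(oriented from smaller to larger index) are pairwise distinct, i.e. the labeling is antimagic. -/
theorem stmt_5 (n : ℕ) (hn : 3 ≤ n)
    (S : ℕ → ℤ)
    (hS : ∀ i, S i = (∑ p ∈ Finset.Icc 1 (i - 1),
        (((p : ℤ) - 1) * n - (p.choose 2 : ℤ) + i - p))
      + ∑ q ∈ Finset.Icc (i + 1) n, (((i : ℤ) - 1) * n - (i.choose 2 : ℤ) + q - i)) :
    ∀ i j : ℕ, 1 ≤ i → i < j → j ≤ n → S i ≠ S j := by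
  have closed : ∀ m k : ℕ, n = m + 1 + k →
      6 * S (m + 1) = 3 * n * m * (m - 1) - (m + 1) * m * (m - 1) + 6 * (m + 1) * m
        - 3 * m * (m + 1) + 6 * k * (m * n) - 3 * k * ((m + 1) * m) + 3 * k * (k + 1) := by
    intro m k hk
    have hin := six_mul_sum_in_labels n ((m + 1 : ℕ) : ℤ) m
    have hout := two_mul_sum_out_labels
      ((((m + 1 : ℕ) : ℤ) - 1) * n - ((m + 1).choose 2 : ℤ)) (m + 1) k
    rw [← hk] at hout
    have hchoose := two_mul_cast_choose_two (m + 1)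
    rw [hS (m + 1), Nat.add_sub_cancel, mul_add, hin]
    push_cast at hout hchoose ⊢
    linear_combination 3 * hout - 3 * k * hchoose
  have step : ∀ i : ℕ, 1 ≤ i → i < n → S i < S (i + 1) := by
    intro i hi hin
    obtain ⟨m, rfl⟩ := Nat.exists_eq_add_of_le' hi
    obtain ⟨k, hk⟩ := Nat.exists_eq_add_of_lt hin
    have h₁ := closed m (k + 1) (by omega)
    have h₂ := closed (m + 1) k (by omega)
    have hn' : (n : ℤ) = m + 1 + k + 1 := by exact_mod_cast hk
    have hdiff : S (m + 1 + 1) - S (m + 1) = n - 2 + k * (k - 1) := by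
      push_cast at h₁ h₂
      rw [hn'] at h₁ h₂ ⊢
      linarith
    have hk0 : (0 : ℤ) ≤ k * (k - 1) := by
      rw [← two_mul_cast_choose_two]
      positivity
    have : (3 : ℤ) ≤ n := by exact_mod_cast hn
    linarith
  have mono : ∀ i j : ℕ, 1 ≤ i → i < j → j ≤ n → S i < S j := by
    intro i j hi hij
    induction j, hij using Nat.le_induction with
    | base => exact fun h => step i hi h
    | succ j hij ih =>
      intro h
      exact (ih (by omega)).trans (step j (by omega) h)
  exact fun i j hi hij hj => (mono i j hi hij hj).ne
end

section
/- Let n ≥ 3 and let F(i,j) = (i-1)·n − C(i,2) + j − i for 1 ≤ i < j ≤ n. Define the vertex sum S_i = Σ_{p=1}^{i-1} F(p,i) + Σ_{q=i+1}^{n} F(i,q) for 1 ≤ i ≤ n. Then the vertex sums are strictly increasing: S_i < S_j whenever 1 ≤ i < j ≤ n. -/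
/-- For `n ≥ 3`, the vertex sums `S_i = Σ_{p=1}^{i-1} F(p,i) + Σ_{q=i+1}^{n} F(i,q)` are
strictly increasing: `S_i < S_j` whenever `1 ≤ i < j ≤ n`. -/
theorem stmt_6 (n : ℕ) (hn : 3 ≤ n)
    (S : ℕ → ℤ)
    (hS : ∀ i, S i = (∑ p ∈ Finset.Icc 1 (i - 1),
        (((p : ℤ) - 1) * n - (p.choose 2 : ℤ) + i - p))
      + ∑ q ∈ Finset.Icc (i + 1) n, (((i : ℤ) - 1) * n - (i.choose 2 : ℤ) + q - i)) :
    ∀ i j : ℕ, 1 ≤ i → i < j → j ≤ n → S i < S j := by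
  have step : ∀ k m : ℕ, k + 2 + m = n → S (k + 1) < S (k + 2) := by
    intro k m hm
    have incoming : ∑ p ∈ Finset.Icc 1 k,
          (((p : ℤ) - 1) * n - (p.choose 2 : ℤ) + ((k + 2 : ℕ) : ℤ) - p)
        = ∑ p ∈ Finset.Icc 1 k,
          (((p : ℤ) - 1) * n - (p.choose 2 : ℤ) + ((k + 1 : ℕ) : ℤ) - p) + k := by
      have hk : (k : ℤ) = ∑ _p ∈ Finset.Icc 1 k, (1 : ℤ) := by simp
      conv_rhs => rw [hk]
      rw [← Finset.sum_add_distrib]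
      refine Finset.sum_congr rfl fun p _ => ?_
      push_cast
      ring
    have choose_succ : ((k + 2).choose 2 : ℤ) = (k + 1).choose 2 + (k + 1) := by
      rw [Nat.choose_succ_succ' (k + 1) 1, Nat.choose_one_right]
      push_cast
      ring
    have outgoing : ∑ q ∈ Finset.Icc (k + 3) n,
          ((((k + 2 : ℕ) : ℤ) - 1) * n - ((k + 2).choose 2 : ℤ) + q - ((k + 2 : ℕ) : ℤ))
        = ∑ q ∈ Finset.Icc (k + 3) n,
          ((((k + 1 : ℕ) : ℤ) - 1) * n - ((k + 1).choose 2 : ℤ) + q - ((k + 1 : ℕ) : ℤ))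
          + (m : ℤ) * m := by
      have hcard : (m : ℤ) * m = ∑ _q ∈ Finset.Icc (k + 3) n, (m : ℤ) := by
        have : n + 1 - (k + 3) = m := by omega
        simp [this]
      rw [hcard, ← Finset.sum_add_distrib]
      refine Finset.sum_congr rfl fun q _ => ?_
      rw [choose_succ, ← hm]
      push_cast
      ring
    have split : Finset.Icc (k + 2) n = insert (k + 2) (Finset.Icc (k + 3) n) := by
      ext q
      simp only [Finset.mem_Icc, Finset.mem_insert]
      omega
    have pos : 0 < (k : ℤ) + m * m := by
      rcases Nat.eq_zero_or_pos k with rfl | hk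
      · have : 0 < m := by omega
        positivity
      · positivity
    rw [hS (k + 1), hS (k + 2), show k + 1 - 1 = k by omega, show k + 2 - 1 = k + 1 by omega,
      show k + 1 + 1 = k + 2 by omega, show k + 2 + 1 = k + 3 by omega,
      Finset.sum_Icc_succ_top (by omega), incoming, outgoing, split,
      Finset.sum_insert (by simp)]
    linarith
  intro i j hi hij
  induction j, hij using Nat.le_induction with
  | base =>
    intro hj
    obtain ⟨k, rfl⟩ := Nat.exists_eq_add_of_le' hi
    exact step k (n - (k + 2)) (by omega)
  | succ j hij ih =>
    intro hj
    obtain ⟨k, rfl⟩ := Nat.exists_eq_add_of_le' (show 1 ≤ j by omega)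
    exact (ih (by omega)).trans (step k (n - (k + 2)) (by omega))
end

section
/- For every n ≥ 3, the complete graph K_n is antimagic: there exists a bijection f from the edge set of K_n to {1, 2, …, C(n,2)} such that the vertex sums Σ_{e incident to u} f(e) are pairwise distinct over all vertices u. -/
theorem Nat.choose_two_add_lt_choose_two {i j k : ℕ} (hij : i < j) (hjk : j < k) :
    j.choose 2 + i < k.choose 2 := by
  have h₁ : (j + 1).choose 2 ≤ k.choose 2 := Nat.choose_le_choose 2 hjk
  have h₂ : (j + 1).choose 2 = j + j.choose 2 := by
    rw [Nat.choose_succ_succ' j 1, Nat.choose_one_right]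
  omega

/-- The colexicographic rank, starting from `1`, of an unordered pair of distinct vertices. -/
def colexRank (n : ℕ) : Sym2 (Fin n) → ℕ :=
  Sym2.lift ⟨fun a b => (max a.val b.val).choose 2 + min a.val b.val + 1,
    fun a b => by simp only [max_comm, min_comm]⟩

theorem colexRank_mk_of_lt {n : ℕ} {a b : Fin n} (h : a < b) :
    colexRank n s(a, b) = b.val.choose 2 + a.val + 1 := by
  have h' : a.val ≤ b.val := h.le
  simp [colexRank, max_eq_right h', min_eq_left h']

theorem exists_lt_of_mem_edgeSet_top {n : ℕ} {e : Sym2 (Fin n)}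
    (he : e ∈ (⊤ : SimpleGraph (Fin n)).edgeSet) : ∃ a b : Fin n, a < b ∧ e = s(a, b) := by
  induction e using Sym2.ind with
  | _ a b =>
    rw [SimpleGraph.mem_edgeSet, SimpleGraph.top_adj] at he
    rcases lt_or_gt_of_ne he with h | h
    · exact ⟨a, b, h, rfl⟩
    · exact ⟨b, a, h, Sym2.eq_swap⟩

theorem bijOn_colexRank (n : ℕ) :
    Set.BijOn (colexRank n) (⊤ : SimpleGraph (Fin n)).edgeSet (Set.Icc 1 (n.choose 2)) := by
  have hmaps : Set.MapsTo (colexRank n) (⊤ : SimpleGraph (Fin n)).edgeSet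
      (Set.Icc 1 (n.choose 2)) := by
    intro e he
    obtain ⟨a, b, hab, rfl⟩ := exists_lt_of_mem_edgeSet_top he
    have := Nat.choose_two_add_lt_choose_two (i := a) hab b.isLt
    rw [colexRank_mk_of_lt hab, Set.mem_Icc]
    omega
  have hinj : Set.InjOn (colexRank n) (⊤ : SimpleGraph (Fin n)).edgeSet := by
    intro e he e' he' h
    obtain ⟨a, b, hab, rfl⟩ := exists_lt_of_mem_edgeSet_top he
    obtain ⟨c, d, hcd, rfl⟩ := exists_lt_of_mem_edgeSet_top he'
    rw [colexRank_mk_of_lt hab, colexRank_mk_of_lt hcd] at h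
    rcases lt_trichotomy b d with hbd | rfl | hbd
    · have := Nat.choose_two_add_lt_choose_two (i := a) hab hbd
      omega
    · have : a = c := Fin.ext (by omega)
      rw [this]
    · have := Nat.choose_two_add_lt_choose_two (i := c) hcd hbd
      omega
  refine ⟨hmaps, hinj, ?_⟩
  rw [← SimpleGraph.coe_edgeFinset, ← Finset.coe_Icc] at *
  refine Finset.surjOn_of_injOn_of_card_le _ hmaps hinj ?_
  rw [SimpleGraph.card_edgeFinset_top_eq_card_choose_two]
  simp

theorem colexRank_mk_lt_colexRank_mk {n : ℕ} {u v w : Fin n} (huv : u < v)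
    (hwu : w ≠ u) (hwv : w ≠ v) : colexRank n s(u, w) < colexRank n s(v, w) := by
  rcases lt_or_gt_of_ne hwu with h | h
  · have := Nat.choose_two_add_lt_choose_two (i := w) h huv
    rw [Sym2.eq_swap, colexRank_mk_of_lt h, Sym2.eq_swap, colexRank_mk_of_lt (h.trans huv)]
    omega
  · rw [colexRank_mk_of_lt h]
    rcases lt_or_gt_of_ne hwv with h' | h'
    · have := Nat.choose_two_add_lt_choose_two (i := u) h h'
      rw [Sym2.eq_swap, colexRank_mk_of_lt h']
      omega
    · rw [colexRank_mk_of_lt h']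
      omega

theorem sum_edgeFinset_top_filter_mem {V M : Type*} [Fintype V] [DecidableEq V]
    [AddCommMonoid M] (f : Sym2 V → M) (u : V) :
    ∑ e ∈ (⊤ : SimpleGraph V).edgeFinset.filter (fun e => u ∈ e), f e =
      ∑ w ∈ Finset.univ.erase u, f s(u, w) := by
  symm
  refine Finset.sum_bij (fun w _ => s(u, w)) ?_ ?_ ?_ (fun _ _ => rfl)
  · intro w hw
    simpa [eq_comm] using hw
  · intro w _ w' _ h
    exact Sym2.congr_right.mp h
  · intro e he
    obtain ⟨he, w, rfl⟩ := Finset.mem_filter.mp he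
    exact ⟨w, by simpa [eq_comm] using he, rfl⟩

theorem sum_colexRank_lt {n : ℕ} (hn : 3 ≤ n) {u v : Fin n} (huv : u < v) :
    (∑ e ∈ (⊤ : SimpleGraph (Fin n)).edgeFinset.filter (fun e => u ∈ e), colexRank n e) <
      ∑ e ∈ (⊤ : SimpleGraph (Fin n)).edgeFinset.filter (fun e => v ∈ e), colexRank n e := by
  rw [sum_edgeFinset_top_filter_mem, sum_edgeFinset_top_filter_mem,
    ← Finset.add_sum_erase _ _ (Finset.mem_erase.mpr ⟨huv.ne', Finset.mem_univ v⟩),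
    ← Finset.add_sum_erase _ _ (Finset.mem_erase.mpr ⟨huv.ne, Finset.mem_univ u⟩),
    Sym2.eq_swap, Finset.erase_right_comm]
  refine Nat.add_lt_add_left (Finset.sum_lt_sum_of_nonempty ?_ ?_) _
  · rw [← Finset.card_pos, Finset.card_erase_of_mem (by simp [huv.ne]),
      Finset.card_erase_of_mem (Finset.mem_univ v), Finset.card_fin]
    omega
  · intro w hw
    simp only [Finset.mem_erase, Finset.mem_univ, and_true] at hw
    exact colexRank_mk_lt_colexRank_mk huv hw.1 hw.2


/-- For every `n ≥ 3`, the complete graph `K_n` is antimagic: there is a bijection `f` from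
its edge set onto `{1, …, C(n,2)}` such that the vertex sums
`Σ_{e incident to u} f(e)` are pairwise distinct. -/
theorem stmt_7 (n : ℕ) (hn : 3 ≤ n) :
    ∃ f : Sym2 (Fin n) → ℕ,
      Set.BijOn f (⊤ : SimpleGraph (Fin n)).edgeSet (Set.Icc 1 (n.choose 2)) ∧
      ∀ u v : Fin n, u ≠ v →
        (∑ e ∈ (⊤ : SimpleGraph (Fin n)).edgeFinset.filter (fun e => u ∈ e), f e) ≠
        (∑ e ∈ (⊤ : SimpleGraph (Fin n)).edgeFinset.filter (fun e => v ∈ e), f e) := by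
  refine ⟨colexRank n, bijOn_colexRank n, fun u v huv => ?_⟩
  rcases lt_or_gt_of_ne huv with h | h
  · convert (sum_colexRank_lt hn h).ne
  · convert (sum_colexRank_lt hn h).ne'
end

section
/- Let n ≥ 3 and let F(i,j) = (i-1)·n − C(i,2) + j − i for 1 ≤ i < j ≤ n. Define the total labeling f by f(v_i) = i for each vertex v_i and f(e) = n + F(i,j) for the edge e from v_i to v_j (i < j), and define the vertex-weight w_i = f(v_i) + Σ_{e incident to v_i} (n + label of e), where the labels of the edges incident to v_i are F(p,i) for p < i and F(i,q) for q > i. Then the vertex-weights w_1, …, w_n are pairwise distinct; in fact w_i < w_j whenever 1 ≤ i < j ≤ n. Hence this total labeling of the complete directed graph on n vertices is vertex-antimagic total. -/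
/-- For `n ≥ 3`, the vertex-weights
`w_i = i + Σ_{p=1}^{i-1} (n + F(p,i)) + Σ_{q=i+1}^{n} (n + F(i,q))` of the super total
labeling (vertex `v_i` labeled `i`, edge from `v_i` to `v_j` labeled `n + F(i,j)`) are
strictly increasing, hence pairwise distinct: the labeling is vertex-antimagic total. -/
theorem stmt_9 (n : ℕ) (hn : 3 ≤ n)
    (w : ℕ → ℤ)
    (hw : ∀ i, w i = (i : ℤ)
      + (∑ p ∈ Finset.Icc 1 (i - 1),
          ((n : ℤ) + (((p : ℤ) - 1) * n - (p.choose 2 : ℤ) + i - p)))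
      + ∑ q ∈ Finset.Icc (i + 1) n,
          ((n : ℤ) + (((i : ℤ) - 1) * n - (i.choose 2 : ℤ) + q - i))) :
    ∀ i j : ℕ, 1 ≤ i → i < j → j ≤ n → w i < w j := by
  have step : ∀ k : ℕ, k + 2 ≤ n → w (k + 1) < w (k + 2) := by
    intro k hk
    have hfirst : ∑ p ∈ Finset.Icc 1 k,
          ((n : ℤ) + (((p : ℤ) - 1) * n - (p.choose 2 : ℤ) + ((k + 1 : ℕ) : ℤ) - p))
        ≤ ∑ p ∈ Finset.Icc 1 k,
          ((n : ℤ) + (((p : ℤ) - 1) * n - (p.choose 2 : ℤ) + ((k + 2 : ℕ) : ℤ) - p)) := by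
      refine Finset.sum_le_sum fun p _ => ?_
      push_cast
      linarith
    have hchoose : ((k + 2).choose 2 : ℤ) = ((k + 1).choose 2 : ℤ) + (k + 1) := by
      rw [Nat.choose_succ_succ' (k + 1) 1, Nat.choose_one_right]
      push_cast
      ring
    have hsecond : ∑ q ∈ Finset.Icc (k + 2 + 1) n,
          ((n : ℤ) + ((((k + 1 : ℕ) : ℤ) - 1) * n - ((k + 1).choose 2 : ℤ) + q
            - ((k + 1 : ℕ) : ℤ)))
        ≤ ∑ q ∈ Finset.Icc (k + 2 + 1) n,
          ((n : ℤ) + ((((k + 2 : ℕ) : ℤ) - 1) * n - ((k + 2).choose 2 : ℤ) + q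
            - ((k + 2 : ℕ) : ℤ))) := by
      refine Finset.sum_le_sum fun q _ => ?_
      rw [hchoose]
      push_cast
      have : (k : ℤ) + 2 ≤ n := by exact_mod_cast hk
      linarith
    rw [hw, hw, show k + 1 - 1 = k by omega, show k + 2 - 1 = k + 1 by omega,
      Finset.sum_Icc_succ_top (by omega), ← Finset.insert_Icc_add_one_left_eq_Icc hk,
      Finset.sum_insert (by simp)]
    push_cast at hfirst hsecond ⊢
    linarith
  intro i j hi hij
  induction j, hij using Nat.le_induction with
  | base =>
    intro hj
    obtain ⟨k, rfl⟩ := Nat.exists_eq_add_of_le' hi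
    exact step k hj
  | succ j hij ih =>
    intro hj
    obtain ⟨k, rfl⟩ : ∃ k, j = k + 1 := ⟨j - 1, by omega⟩
    exact (ih (by omega)).trans (step k hj)
end

section
/- Let n ≥ 3 and let F(i,j) = (i-1)·n − C(i,2) + j − i for 1 ≤ i < j ≤ n. Define the edge-weight of the pair (i,j) as W(i,j) = n·i + 2j − C(i,2). Suppose that for all quadruples with 1 ≤ i < i' < j' < j ≤ n one has 2n ≠ 4(j−j')/(i'−i) + (i'+i−1), i.e., (i'−i)·(2n − i' − i + 1) ≠ 4(j−j'). Then the edge-weights W(i,j) are pairwise distinct over all pairs (i,j) with 1 ≤ i < j ≤ n; that is, the total labeling assigning label i to vertex v_i and label n + F(i,j) to the edge from v_i to v_j is super edge-antimagic total. -/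
theorem Nat.two_mul_cast_choose_two (m : ℕ) : 2 * (m.choose 2 : ℤ) = m * (m - 1) := by
  induction m with
  | zero => simp
  | succ k ih =>
    rw [Nat.choose_succ_succ' k 1, Nat.choose_one_right]
    push_cast
    linarith

/-- For `n ≥ 3`, if for all quadruples `1 ≤ i < i' < j' < j ≤ n` one has
`(i'−i)·(2n − i' − i + 1) ≠ 4(j−j')`, then the edge-weights `W(i,j) = n·i + 2j − C(i,2)`
are pairwise distinct over the pairs `1 ≤ i < j ≤ n`; i.e. the super total labeling is
super edge-antimagic total. -/
theorem stmt_11 (n : ℕ) (hn : 3 ≤ n)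
    (W : ℕ → ℕ → ℤ)
    (hW : ∀ i j, W i j = (n : ℤ) * i + 2 * j - (i.choose 2 : ℤ))
    (h : ∀ i i' j' j : ℕ, 1 ≤ i → i < i' → i' < j' → j' < j → j ≤ n →
      ((i' : ℤ) - i) * (2 * n - i' - i + 1) ≠ 4 * ((j : ℤ) - j')) :
    ∀ i j i' j' : ℕ, 1 ≤ i → i < j → j ≤ n → 1 ≤ i' → i' < j' → j' ≤ n →
      (i, j) ≠ (i', j') → W i j ≠ W i' j' := by
  have ne_of_lt : ∀ i j i' j' : ℕ, 1 ≤ i → i < i' → i' < j' → j ≤ n → j' ≤ n →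
      W i j ≠ W i' j' := by
    intro i j i' j' hi hii' hij' hj hj' heq
    rw [hW, hW] at heq
    have key : ((i' : ℤ) - i) * (2 * n - i' - i + 1) = 4 * ((j : ℤ) - j') := by
      linarith [Nat.two_mul_cast_choose_two i, Nat.two_mul_cast_choose_two i']
    have hpos : 0 < ((i' : ℤ) - i) * (2 * n - i' - i + 1) := mul_pos (by omega) (by omega)
    exact h i i' j' j hi hii' hij' (by omega) hj key
  intro i j i' j' hi hij hj hi' hij' hj' hne heq
  rcases lt_trichotomy i i' with hlt | rfl | hgt
  · exact ne_of_lt i j i' j' hi hlt hij' hj hj' heq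
  · rw [hW, hW] at heq
    exact hne (Prod.ext rfl (by simp only; omega))
  · exact ne_of_lt i' j' i j hi' hgt hij hj' hj heq.symm
end

section
/- Let n ≥ 3 and define the edge-weight W(i,j) = n·i + 2j − C(i,2) for 1 ≤ i < j ≤ n. If (i,j) and (i',j') are pairs with 1 ≤ i < j ≤ n and 1 ≤ i' < j' ≤ n such that either (i < i' and j ≤ j') or (i = i' and j < j'), then W(i,j) < W(i',j'). -/
/-- The function `a ↦ n * a - a.choose 2` is strictly increasing on `{0, …, n}`. -/
theorem choose_two_add_mul_lt {n a b : ℕ} (hab : a < b) (hb : b ≤ n) :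
    b.choose 2 + n * a < a.choose 2 + n * b := by
  have step (k : ℕ) : (k + 1).choose 2 = k + k.choose 2 := by
    rw [Nat.choose_succ_succ' k 1, Nat.choose_one_right]
  induction b, hab using Nat.le_induction with
  | base => rw [step]; lia
  | succ b _ ih =>
    have := ih (by lia)
    rw [step]
    lia

/-- For `n ≥ 3` and pairs `1 ≤ i < j ≤ n`, `1 ≤ i' < j' ≤ n` with either
(`i < i'` and `j ≤ j'`) or (`i = i'` and `j < j'`), the edge-weights
`W(i,j) = n·i + 2j − C(i,2)` satisfy `W(i,j) < W(i',j')`. -/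
theorem stmt_12 (n : ℕ) (hn : 3 ≤ n)
    (W : ℕ → ℕ → ℤ)
    (hW : ∀ i j, W i j = (n : ℤ) * i + 2 * j - (i.choose 2 : ℤ))
    (i j i' j' : ℕ) (hi : 1 ≤ i) (hij : i < j) (hj : j ≤ n)
    (hi' : 1 ≤ i') (hij' : i' < j') (hj' : j' ≤ n)
    (hcase : (i < i' ∧ j ≤ j') ∨ (i = i' ∧ j < j')) :
    W i j < W i' j' := by
  rw [hW, hW]
  rcases hcase with ⟨hlt, hle⟩ | ⟨rfl, hlt⟩
  · have h := choose_two_add_mul_lt hlt (hij'.le.trans hj')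
    zify at h hle
    linarith
  · zify at hlt
    linarith
end

section
/- Let n ≥ 3 and let F(i,j) = (i-1)·n − C(i,2) + j − i for 1 ≤ i < j ≤ n. Suppose that for all quadruples with 1 ≤ i < i' < j' < j ≤ n one has (i'−i)·(2n − i' − i + 1) ≠ 4(j−j'). Then the total labeling assigning label i to vertex v_i and label n + F(i,j) to the edge between v_i and v_j is a totally antimagic total labeling of the complete graph K_n: both all vertex-weights and all edge-weights are pairwise distinct. -/
/-- The vertex-weights of the labeling increase by `m + 1 + (n - m - 2) ^ 2` from `v_(m+1)` to
`v_(m+2)`. -/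
lemma vertexWeight_succ_sub (n : ℕ) (w : ℕ → ℤ)
    (hw : ∀ i, w i = (i : ℤ)
      + (∑ p ∈ Finset.Icc 1 (i - 1),
          ((n : ℤ) + (((p : ℤ) - 1) * n - (p.choose 2 : ℤ) + i - p)))
      + ∑ q ∈ Finset.Icc (i + 1) n,
          ((n : ℤ) + (((i : ℤ) - 1) * n - (i.choose 2 : ℤ) + q - i)))
    (m : ℕ) (hm : m + 2 ≤ n) :
    w (m + 2) - w (m + 1) = m + 1 + ((n : ℤ) - m - 2) ^ 2 := by
  have lower : ∑ p ∈ Finset.Icc 1 m,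
        ((n : ℤ) + (((p : ℤ) - 1) * n - (p.choose 2 : ℤ) + ((m + 2 : ℕ) : ℤ) - p))
      = ∑ p ∈ Finset.Icc 1 m,
        ((n : ℤ) + (((p : ℤ) - 1) * n - (p.choose 2 : ℤ) + ((m + 1 : ℕ) : ℤ) - p)) + m := by
    rw [← sub_eq_iff_eq_add', ← Finset.sum_sub_distrib]
    rw [Finset.sum_congr rfl (g := fun _ => (1 : ℤ)) (fun p _ => by push_cast; ring)]
    simp
  have upper : ∑ q ∈ Finset.Icc (m + 3) n, ((n : ℤ) + ((((m + 2 : ℕ) : ℤ) - 1) * n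
          - ((m + 2).choose 2 : ℤ) + q - ((m + 2 : ℕ) : ℤ)))
      = ∑ q ∈ Finset.Icc (m + 3) n, ((n : ℤ) + ((((m + 1 : ℕ) : ℤ) - 1) * n
          - ((m + 1).choose 2 : ℤ) + q - ((m + 1 : ℕ) : ℤ))) + ((n : ℤ) - m - 2) ^ 2 := by
    have hc : (m + 2).choose 2 = (m + 1) + (m + 1).choose 2 := by
      rw [Nat.choose_succ_succ' (m + 1) 1, Nat.choose_one_right]
    rw [← sub_eq_iff_eq_add', ← Finset.sum_sub_distrib]
    rw [Finset.sum_congr rfl (g := fun _ => (n : ℤ) - m - 2)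
      (fun q _ => by rw [hc]; push_cast; ring)]
    rw [Finset.sum_const, Nat.card_Icc, nsmul_eq_mul, show n + 1 - (m + 3) = n - (m + 2) by omega,
      Nat.cast_sub hm]
    push_cast
    ring
  rw [hw, hw, show m + 2 - 1 = m + 1 from rfl, show m + 1 - 1 = m from rfl,
    Finset.sum_Icc_succ_top (by omega), lower, upper,
    ← Finset.add_sum_Ioc_eq_sum_Icc (show m + 1 + 1 ≤ n from hm),
    show Finset.Ioc (m + 1 + 1) n = Finset.Icc (m + 3) n by ext; simp; omega]
  push_cast
  ring

lemma two_mul_cast_choose_two_s13 (k : ℕ) : 2 * (k.choose 2 : ℤ) = k * (k - 1) := by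
  induction k with
  | zero => simp
  | succ k ih =>
    rw [Nat.choose_succ_succ' k 1, Nat.choose_one_right]
    push_cast
    linarith

/-- For `n ≥ 3`, if for all quadruples `1 ≤ i < i' < j' < j ≤ n` one has
`(i'−i)·(2n − i' − i + 1) ≠ 4(j−j')`, then the total labeling of `K_n` assigning label `i`
to vertex `v_i` and label `n + F(i,j)` to the edge between `v_i` and `v_j` is totally
antimagic total: all vertex-weights are pairwise distinct and all edge-weights are
pairwise distinct. -/
theorem stmt_13 (n : ℕ) (hn : 3 ≤ n)
    (w : ℕ → ℤ)
    (hw : ∀ i, w i = (i : ℤ)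
      + (∑ p ∈ Finset.Icc 1 (i - 1),
          ((n : ℤ) + (((p : ℤ) - 1) * n - (p.choose 2 : ℤ) + i - p)))
      + ∑ q ∈ Finset.Icc (i + 1) n,
          ((n : ℤ) + (((i : ℤ) - 1) * n - (i.choose 2 : ℤ) + q - i)))
    (W : ℕ → ℕ → ℤ)
    (hW : ∀ i j, W i j = (i : ℤ) + (j : ℤ)
      + ((n : ℤ) + (((i : ℤ) - 1) * n - (i.choose 2 : ℤ) + j - i)))
    (h : ∀ i i' j' j : ℕ, 1 ≤ i → i < i' → i' < j' → j' < j → j ≤ n →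
      ((i' : ℤ) - i) * (2 * n - i' - i + 1) ≠ 4 * ((j : ℤ) - j')) :
    (∀ i j : ℕ, 1 ≤ i → i < j → j ≤ n → w i ≠ w j) ∧
    (∀ i j i' j' : ℕ, 1 ≤ i → i < j → j ≤ n → 1 ≤ i' → i' < j' → j' ≤ n →
      (i, j) ≠ (i', j') → W i j ≠ W i' j') := by
  constructor
  · intro i j hi hij hj
    have step : ∀ k, 1 ≤ k → k + 1 ≤ n → w k < w (k + 1) := by
      intro k hk hkn
      obtain ⟨m, rfl⟩ := Nat.exists_eq_add_of_le' hk
      have := vertexWeight_succ_sub n w hw m hkn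
      have : w (m + 1) < w (m + 2) := by nlinarith [sq_nonneg ((n : ℤ) - m - 2)]
      exact this
    have key : ∀ k, i + 1 ≤ k → k ≤ n → w i < w k := by
      intro k hk
      induction k, hk using Nat.le_induction with
      | base => exact step i hi
      | succ k hk ih => exact fun hkn => (ih (by omega)).trans (step k (by omega) hkn)
    exact (key j hij hj).ne
  · have key : ∀ i j i' j' : ℕ, 1 ≤ i → j ≤ n → i' < j' → j' ≤ n → i < i' →
        W i j ≠ W i' j' := by
      intro i j i' j' hi hj hij' hj' hii' heq
      rw [hW, hW] at heq
      have hdiff : ((i' : ℤ) - i) * (2 * n - i' - i + 1) = 4 * ((j : ℤ) - j') := by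
        linarith [two_mul_cast_choose_two_s13 i, two_mul_cast_choose_two_s13 i']
      have hpos : 0 < ((i' : ℤ) - i) * (2 * n - i' - i + 1) :=
        mul_pos (by omega) (by omega)
      exact h i i' j' j hi hii' hij' (by omega) hj hdiff
    intro i j i' j' hi _ hj hi' hij' hj' hne heq
    rcases lt_trichotomy i i' with hlt | rfl | hgt
    · exact key i j i' j' hi hj hij' hj' hlt heq
    · rw [hW, hW] at heq
      exact hne (by rw [show j = j' by omega])
    · exact key i' j' i j hi' hj' (by assumption) hj hgt heq.symm
end

section
/- Let n ≥ 3 and let i, j be integers with 1 ≤ i < j ≤ n. Then (as rational numbers) (j² + ij + i²)/3 − (n−1)(i+j) + n² − n − 4/3 > 0. -/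
/-- The integer form of the inequality, in the distances `a = n - i` and `b = n - j`. -/
theorem quadratic_form_pos {n a b : ℤ} (hn : 3 ≤ n) (hb : 0 ≤ b) (hab : b < a) (ha : a < n) :
    0 < 3 * n - 3 * (a + b) + a ^ 2 + a * b + b ^ 2 - 4 := by
  rcases hb.eq_or_lt with rfl | hb
  · rcases (show 1 ≤ a by lia).eq_or_lt with rfl | ha'
    · lia
    · nlinarith
  · nlinarith [mul_pos hb (hb.trans hab)]

/-- For `n ≥ 3` and integers `1 ≤ i < j ≤ n`, as rational numbers,
`(j² + ij + i²)/3 − (n−1)(i+j) + n² − n − 4/3 > 0`. -/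
theorem stmt_16 (n i j : ℤ) (hn : 3 ≤ n) (hi : 1 ≤ i) (hij : i < j) (hj : j ≤ n) :
    (0 : ℚ) < ((j : ℚ) ^ 2 + (i : ℚ) * j + (i : ℚ) ^ 2) / 3
      - ((n : ℚ) - 1) * ((i : ℚ) + j) + (n : ℚ) ^ 2 - (n : ℚ) - 4 / 3 := by
  have h := quadratic_form_pos (n := n) (a := n - i) (b := n - j) hn (by lia) (by lia) (by lia)
  have hq : (0 : ℚ) < 3 * n - 3 * ((n - i) + (n - j)) + (n - i) ^ 2
      + (n - i) * (n - j) + (n - j) ^ 2 - 4 := by exact_mod_cast h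
  linarith
end
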